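/- Let g(x) = λx for λ > 0 and B ∈ ℝ^{m×n} with SVD B = U Diag(σ(B)) Vᵀ. Then the matrix U Diag((σᵢ(B) - λ)₊) Vᵀ is the unique minimizer of X ↦ λ‖X‖_* + (1/2)‖X - B‖_F², where ‖·‖_* is the nuclear norm and (t)₊ = max(t, 0). -/

import Mathlib

open Set Matrix

noncomputable def svUnsorted {m n : ℕ} (A : Matrix (Fin m) (Fin n) ℝ) : Fin m → ℝ :=
  fun i => Real.sqrt ((Matrix.isHermitian_mul_conjTranspose_self A).eigenvalues i)

/-- `singularValues A i` is the `i`-th largest singular value of `A`. -/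
noncomputable def singularValues {m n : ℕ} (A : Matrix (Fin m) (Fin n) ℝ) : Fin m → ℝ :=
  fun i => svUnsorted A (Tuple.sort (fun j => - svUnsorted A j) i)

/-- The `m × n` rectangular diagonal matrix with diagonal entries `d`. -/
def rectDiag {m n : ℕ} (d : Fin m → ℝ) : Matrix (Fin m) (Fin n) ℝ :=
  Matrix.of fun i j => if (i : ℕ) = (j : ℕ) then d i else 0

/-- The squared Frobenius norm. -/
def frobSq {m n : ℕ} (X : Matrix (Fin m) (Fin n) ℝ) : ℝ :=
  ∑ i, ∑ j, (X i j)^2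

theorem sum_singularValues {m n : ℕ} (A : Matrix (Fin m) (Fin n) ℝ) :
    ∑ i, singularValues A i = ∑ i, svUnsorted A i :=
  Equiv.sum_comp (Tuple.sort fun j => -svUnsorted A j) (svUnsorted A)

theorem singularValues_nonneg {m n : ℕ} (A : Matrix (Fin m) (Fin n) ℝ) (i : Fin m) :
    0 ≤ singularValues A i :=
  Real.sqrt_nonneg _

theorem rectDiag_mul_transpose {m n : ℕ} (hmn : m ≤ n) (d e : Fin m → ℝ) :
    (rectDiag d : Matrix (Fin m) (Fin n) ℝ) * (rectDiag e : Matrix (Fin m) (Fin n) ℝ)ᵀ =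
      diagonal fun i => d i * e i := by
  ext i j
  rw [mul_apply, Finset.sum_eq_single (Fin.castLE hmn i)]
  · by_cases h : i = j
    · subst h
      simp [rectDiag]
    · have h' : ¬ (j : ℕ) = i := fun h' => h (Fin.ext h'.symm)
      simp [rectDiag, diagonal_apply_ne _ h, h']
  · intro k _ hk
    have h' : ¬ (i : ℕ) = k := fun h' => hk (Fin.ext (by simpa using h'.symm))
    simp [rectDiag, h']
  · simp

theorem mul_rectDiag_mul_transpose {m n : ℕ} (hmn : m ≤ n) (U : Matrix (Fin m) (Fin m) ℝ)
    {V : Matrix (Fin n) (Fin n) ℝ} (hV : Vᵀ * V = 1) (d e : Fin m → ℝ) :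
    (U * rectDiag (n := n) d * Vᵀ) * (U * rectDiag (n := n) e * Vᵀ)ᵀ =
      U * diagonal (fun i => d i * e i) * Uᵀ := by
  rw [← rectDiag_mul_transpose hmn]
  simp only [transpose_mul, transpose_transpose, Matrix.mul_assoc]
  rw [← Matrix.mul_assoc Vᵀ V, hV, Matrix.one_mul]

theorem trace_mul_rectDiag {m n : ℕ} (hmn : m ≤ n) {U : Matrix (Fin m) (Fin m) ℝ}
    {V : Matrix (Fin n) (Fin n) ℝ} (hU : Uᵀ * U = 1) (hV : Vᵀ * V = 1) (d e : Fin m → ℝ) :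
    trace ((U * rectDiag (n := n) d * Vᵀ) * (U * rectDiag (n := n) e * Vᵀ)ᵀ) = ∑ i, d i * e i := by
  rw [mul_rectDiag_mul_transpose hmn U hV, trace_mul_comm, ← Matrix.mul_assoc, hU,
    Matrix.one_mul, trace_diagonal]

/-- The nuclear norm of a matrix given by a singular value decomposition. -/
theorem sum_singularValues_mul_rectDiag {m n : ℕ} (hmn : m ≤ n) {U : Matrix (Fin m) (Fin m) ℝ}
    {V : Matrix (Fin n) (Fin n) ℝ} (hU : Uᵀ * U = 1) (hV : Vᵀ * V = 1) {d : Fin m → ℝ}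
    (hd : ∀ i, 0 ≤ d i) :
    ∑ i, singularValues (U * rectDiag (n := n) d * Vᵀ) i = ∑ i, d i := by
  rw [sum_singularValues]
  set A := U * rectDiag (n := n) d * Vᵀ with hA
  have hH := isHermitian_mul_conjTranspose_self A
  have hchar : (A * Aᴴ).charpoly = (diagonal fun i => d i * d i).charpoly := by
    rw [conjTranspose_eq_transpose_of_trivial, hA, mul_rectDiag_mul_transpose hmn U hV,
      Matrix.mul_assoc, charpoly_mul_comm, Matrix.mul_assoc, hU, Matrix.mul_one]
  have hroots := hH.roots_charpoly_eq_eigenvalues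
  rw [hchar, charpoly_diagonal, Finset.prod, ← Function.comp_def (fun a : ℝ => Polynomial.X - Polynomial.C a),
    ← Multiset.map_map, Polynomial.roots_multiset_prod_X_sub_C] at hroots
  have hsum := congrArg (fun r => (r.map Real.sqrt).sum) hroots
  simp only [Multiset.map_map] at hsum
  refine hsum.symm.trans (Finset.sum_congr rfl fun i _ => ?_)
  exact Real.sqrt_mul_self (hd i)

theorem trace_mul_transpose_le_sum_singularValues {m n : ℕ} {W X : Matrix (Fin m) (Fin n) ℝ}
    (hW : ∀ x : Fin m → ℝ, (Wᵀ *ᵥ x) ⬝ᵥ (Wᵀ *ᵥ x) ≤ x ⬝ᵥ x) :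
    trace (W * Xᵀ) ≤ ∑ i, singularValues X i := by
  rw [sum_singularValues]
  have hH := isHermitian_mul_conjTranspose_self X
  set Q : Matrix (Fin m) (Fin m) ℝ := hH.eigenvectorUnitary.1
  have hQQ : Q * Qᵀ = 1 := by
    rw [← conjTranspose_eq_transpose_of_trivial]
    exact Unitary.coe_mul_star_self hH.eigenvectorUnitary
  have hQQ' : Qᵀ * Q = 1 := mul_eq_one_comm.mp hQQ
  have hdiag : (Qᵀ * X) * (Qᵀ * X)ᵀ = diagonal hH.eigenvalues := by
    have h := hH.conjStarAlgAut_star_eigenvectorUnitary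
    rw [Unitary.conjStarAlgAut_star_apply] at h
    rw [transpose_mul, transpose_transpose, Matrix.mul_assoc, ← Matrix.mul_assoc X,
      ← Matrix.mul_assoc, ← conjTranspose_eq_transpose_of_trivial Q,
      ← conjTranspose_eq_transpose_of_trivial X]
    exact h
  have htr : trace (W * Xᵀ) = trace ((Qᵀ * W) * (Qᵀ * X)ᵀ) := by
    rw [transpose_mul, transpose_transpose, Matrix.mul_assoc, trace_mul_comm Qᵀ, Matrix.mul_assoc,
      Matrix.mul_assoc, hQQ, Matrix.mul_one]
  rw [htr]
  refine Finset.sum_le_sum fun i _ => ?_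
  have hX : ∑ j, (Qᵀ * X) i j ^ 2 = hH.eigenvalues i := by
    have := congrFun (congrFun hdiag i) i
    rw [mul_apply] at this
    simpa [sq] using this
  have hR : ∑ j, (Qᵀ * W) i j ^ 2 ≤ 1 := by
    have h1 : (Q.col i) ⬝ᵥ (Q.col i) = 1 := by
      simpa [mul_apply, dotProduct] using congrFun (congrFun hQQ' i) i
    have h2 := hW (Q.col i)
    rw [h1] at h2
    refine le_of_eq_of_le ?_ h2
    simp only [dotProduct, mulVec, mul_apply, sq, transpose_apply, col_apply, mul_comm]
  have hcs := Real.sum_mul_le_sqrt_mul_sqrt Finset.univ (fun j => (Qᵀ * W) i j)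
    (fun j => (Qᵀ * X) i j)
  rw [hX] at hcs
  exact hcs.trans (mul_le_of_le_one_left (Real.sqrt_nonneg _) (Real.sqrt_le_one.mpr hR))

theorem dotProduct_transpose_mulVec_le {m n : ℕ} (hmn : m ≤ n) {U : Matrix (Fin m) (Fin m) ℝ}
    {V : Matrix (Fin n) (Fin n) ℝ} (hU : Uᵀ * U = 1) (hV : Vᵀ * V = 1) {c : Fin m → ℝ}
    (hc : ∀ i, c i * c i ≤ 1) (x : Fin m → ℝ) :
    ((U * rectDiag (n := n) c * Vᵀ)ᵀ *ᵥ x) ⬝ᵥ ((U * rectDiag (n := n) c * Vᵀ)ᵀ *ᵥ x) ≤ x ⬝ᵥ x := by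
  have hU' : U * Uᵀ = 1 := mul_eq_one_comm.mp hU
  have h1 : ((U * rectDiag (n := n) c * Vᵀ)ᵀ *ᵥ x) ⬝ᵥ ((U * rectDiag (n := n) c * Vᵀ)ᵀ *ᵥ x) =
      (Uᵀ *ᵥ x) ⬝ᵥ (diagonal (fun i => c i * c i) *ᵥ (Uᵀ *ᵥ x)) := by
    rw [mulVec_transpose, ← dotProduct_mulVec, ← mulVec_transpose, mulVec_mulVec,
      mul_rectDiag_mul_transpose hmn U hV, mulVec_transpose, ← dotProduct_mulVec,
      ← mulVec_transpose, mulVec_mulVec, mulVec_mulVec, Matrix.mul_assoc]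
  have h2 : x ⬝ᵥ x = (Uᵀ *ᵥ x) ⬝ᵥ (Uᵀ *ᵥ x) := by
    rw [mulVec_transpose, ← dotProduct_mulVec, ← mulVec_transpose, mulVec_mulVec, hU',
      one_mulVec]
  rw [h1, h2]
  refine Finset.sum_le_sum fun i _ => ?_
  rw [mulVec_diagonal]
  nlinarith [hc i, mul_self_nonneg ((Uᵀ *ᵥ x) i)]

theorem frobSq_eq_trace {m n : ℕ} (X : Matrix (Fin m) (Fin n) ℝ) :
    frobSq X = trace (X * Xᵀ) := by
  simp [frobSq, trace, mul_apply, sq]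

theorem frobSq_nonneg {m n : ℕ} (X : Matrix (Fin m) (Fin n) ℝ) : 0 ≤ frobSq X := by
  unfold frobSq
  positivity

theorem eq_zero_of_frobSq_nonpos {m n : ℕ} {X : Matrix (Fin m) (Fin n) ℝ} (h : frobSq X ≤ 0) :
    X = 0 := by
  have h0 := le_antisymm h (frobSq_nonneg X)
  rwa [frobSq_eq_trace, ← conjTranspose_eq_transpose_of_trivial,
    trace_mul_conjTranspose_self_eq_zero_iff] at h0

theorem frobSq_sub {m n : ℕ} (X Z B : Matrix (Fin m) (Fin n) ℝ) :
    frobSq (X - B) + 2 * trace ((B - Z) * Xᵀ) =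
      frobSq (Z - B) + 2 * trace ((B - Z) * Zᵀ) + frobSq (X - Z) := by
  simp only [frobSq, trace, diag_apply, mul_apply, Finset.mul_sum, ← Finset.sum_add_distrib,
    transpose_apply, Matrix.sub_apply]
  refine Finset.sum_congr rfl fun i _ => Finset.sum_congr rfl fun j _ => ?_
  ring

/-- The objective grows at least quadratically away from the thresholded matrix. -/
theorem svt_quadratic_growth {m n : ℕ} (hmn : m ≤ n) {lam : ℝ} (hlam : 0 < lam)
    {U : Matrix (Fin m) (Fin m) ℝ} {V : Matrix (Fin n) (Fin n) ℝ}
    (hU : Uᵀ * U = 1) (hV : Vᵀ * V = 1) {s : Fin m → ℝ} (hs : ∀ i, 0 ≤ s i)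
    {B Z : Matrix (Fin m) (Fin n) ℝ} (hB : B = U * rectDiag (n := n) s * Vᵀ)
    (hZ : Z = U * rectDiag (n := n) (fun i => max (s i - lam) 0) * Vᵀ) (X : Matrix (Fin m) (Fin n) ℝ) :
    lam * (∑ i, singularValues Z i) + (1/2) * frobSq (Z - B) + (1/2) * frobSq (X - Z) ≤
      lam * (∑ i, singularValues X i) + (1/2) * frobSq (X - B) := by
  set c : Fin m → ℝ := fun i => min (s i) lam / lam with hc
  have hBZ : B - Z = lam • (U * rectDiag (n := n) c * Vᵀ) := by
    have : (rectDiag s : Matrix (Fin m) (Fin n) ℝ) - rectDiag (fun i => max (s i - lam) 0) =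
        lam • rectDiag c := by
      ext i j
      simp only [rectDiag, Matrix.sub_apply, Matrix.smul_apply, of_apply, smul_eq_mul, hc]
      split_ifs
      · rw [mul_div_cancel₀ _ hlam.ne']
        rcases le_total (s i) lam with h | h
        · rw [min_eq_left h, max_eq_right (by linarith)]; ring
        · rw [min_eq_right h, max_eq_left (by linarith)]; ring
      · ring
    rw [hB, hZ, ← Matrix.sub_mul, ← Matrix.mul_sub, this, Matrix.mul_smul, Matrix.smul_mul]
  have hc1 : ∀ i, c i * c i ≤ 1 := fun i => by
    have h0 : 0 ≤ c i := div_nonneg (le_min (hs i) hlam.le) hlam.le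
    have h1 : c i ≤ 1 := (div_le_one hlam).mpr (min_le_right _ _)
    nlinarith
  have hX := trace_mul_transpose_le_sum_singularValues (X := X)
    (dotProduct_transpose_mulVec_le hmn hU hV hc1)
  have hZZ : trace ((U * rectDiag (n := n) c * Vᵀ) * Zᵀ) = ∑ i, singularValues Z i := by
    rw [hZ, trace_mul_rectDiag hmn hU hV,
      sum_singularValues_mul_rectDiag hmn hU hV fun i => le_max_right _ _]
    refine Finset.sum_congr rfl fun i _ => ?_
    rcases le_total (s i) lam with h | h
    · rw [max_eq_right (by linarith), mul_zero]
    · simp only [hc]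
      rw [min_eq_right h, div_self hlam.ne', one_mul]
  have key := frobSq_sub X Z B
  rw [hBZ, Matrix.smul_mul, Matrix.smul_mul, trace_smul, trace_smul, hZZ, smul_eq_mul,
    smul_eq_mul] at key
  nlinarith [mul_le_mul_of_nonneg_left hX hlam.le]

theorem isMinOn_and_unique_of_growth {m n : ℕ} {f : Matrix (Fin m) (Fin n) ℝ → ℝ}
    {Z : Matrix (Fin m) (Fin n) ℝ} (hf : ∀ X, f Z + (1/2) * frobSq (X - Z) ≤ f X) :
    IsMinOn f Set.univ Z ∧ ∀ Y, IsMinOn f Set.univ Y → Y = Z := by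
  refine ⟨isMinOn_iff.mpr fun X _ => ?_, fun Y hY => ?_⟩
  · linarith [hf X, frobSq_nonneg (X - Z)]
  · refine sub_eq_zero.mp (eq_zero_of_frobSq_nonpos ?_)
    linarith [hf Y, isMinOn_iff.mp hY Z (Set.mem_univ Z)]

/-- Singular Value Thresholding: soft-thresholding the singular values gives the
unique minimizer of `X ↦ λ‖X‖_* + ½‖X - B‖_F²`. -/
theorem svt_unique_minimizer {m n : ℕ} (hmn : m ≤ n) (lam : ℝ) (hlam : 0 < lam)
    (B : Matrix (Fin m) (Fin n) ℝ)
    (U : Matrix (Fin m) (Fin m) ℝ) (V : Matrix (Fin n) (Fin n) ℝ)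
    (hU : Uᵀ * U = 1) (hV : Vᵀ * V = 1)
    (hSVD : B = U * rectDiag (singularValues B) * Vᵀ) :
    IsMinOn (fun X : Matrix (Fin m) (Fin n) ℝ =>
        lam * (∑ i, singularValues X i) + (1/2) * frobSq (X - B))
      Set.univ (U * rectDiag (fun i => max (singularValues B i - lam) 0) * Vᵀ) ∧
    ∀ Y : Matrix (Fin m) (Fin n) ℝ,
      IsMinOn (fun X : Matrix (Fin m) (Fin n) ℝ =>
          lam * (∑ i, singularValues X i) + (1/2) * frobSq (X - B))
        Set.univ Y →
      Y = U * rectDiag (fun i => max (singularValues B i - lam) 0) * Vᵀ := by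
  exact isMinOn_and_unique_of_growth
    (svt_quadratic_growth hmn hlam hU hV (singularValues_nonneg B) hSVD rfl)
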